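/- arXiv:2006.02998 — 2 statements merged into one kernel-verified Lean document; each statement's English description precedes it below -/
import Mathlib

section
/- Let G be a finite connected simple graph and x a corner of G. If c(G − x) ≥ 2, then c(G) = c(G − x); if c(G − x) = 1, then c(G) ∈ {1, 2}. -/
open SimpleGraph

/-- `CopsWinFrom G c r` : in the game of cops and robbers on `G` with the cops at
positions `c` and the robber at `r`, with the cops to move, the cops can guarantee
to catch the robber.  A piece may stay put or move along an edge on its turn;
the robber is caught as soon as some cop occupies its vertex. -/
inductive CopsWinFrom {V : Type*} (G : SimpleGraph V) {k : ℕ} : (Fin k → V) → V → Prop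
  | caught (c : Fin k → V) (r : V) (h : ∃ i, c i = r) : CopsWinFrom G c r
  | stepCatch (c : Fin k → V) (r : V) (c' : Fin k → V)
      (hmove : ∀ i, c' i = c i ∨ G.Adj (c i) (c' i)) (h : ∃ i, c' i = r) :
      CopsWinFrom G c r
  | step (c : Fin k → V) (r : V) (c' : Fin k → V)
      (hmove : ∀ i, c' i = c i ∨ G.Adj (c i) (c' i))
      (h : ∀ r' : V, (r' = r ∨ G.Adj r r') → CopsWinFrom G c' r') :
      CopsWinFrom G c r

/-- `k` cops have a winning strategy on `G`: they can choose initial positions so that,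
whatever initial vertex the robber picks, they catch the robber. -/
def CopsWin {V : Type*} (G : SimpleGraph V) (k : ℕ) : Prop :=
  ∃ c : Fin k → V, ∀ r : V, CopsWinFrom G c r

/-- The cop number of a connected graph: the least number of cops that can always
catch the robber. -/
noncomputable def copNumberConn {V : Type*} (G : SimpleGraph V) : ℕ :=
  sInf {k | CopsWin G k}

/-- The cop number of a (possibly disconnected) graph: the maximum of the cop numbers
of its connected components. -/
noncomputable def copNumber {V : Type*} (G : SimpleGraph V) : ℕ :=
  sSup {n | ∃ C : G.ConnectedComponent, n = copNumberConn (G.induce C.supp)}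

/-- The closed neighbourhood `N[v]` of a vertex. -/
def closedNbhd {V : Type*} (G : SimpleGraph V) (v : V) : Set V :=
  insert v (G.neighborSet v)
/-- `x` is cornered by `u` : `u ≠ x` and `N(x) ⊆ N[u]`. -/
def IsCorneredBy {V : Type*} (G : SimpleGraph V) (x u : V) : Prop :=
  u ≠ x ∧ G.neighborSet x ⊆ closedNbhd G u

/-- `x` is a corner of `G`. -/
def IsCornerVertex {V : Type*} (G : SimpleGraph V) (x : V) : Prop :=
  ∃ u, IsCorneredBy G x u

/-- A map between graphs sending each edge to an edge or to a single vertex. -/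
def IsReflexiveHom {V W : Type*} (G : SimpleGraph V) (H : SimpleGraph W) (f : V → W) : Prop :=
  ∀ ⦃a b : V⦄, G.Adj a b → f b = f a ∨ H.Adj (f a) (f b)

theorem IsReflexiveHom.map_move {V W : Type*} {G : SimpleGraph V} {H : SimpleGraph W} {f : V → W}
    (hf : IsReflexiveHom G H f) {a b : V} (h : b = a ∨ G.Adj a b) :
    f b = f a ∨ H.Adj (f a) (f b) :=
  h.elim (fun h => Or.inl (congrArg f h)) (fun h => hf h)

theorem IsReflexiveHom.reachable {V W : Type*} {G : SimpleGraph V} {H : SimpleGraph W} {f : V → W}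
    (hf : IsReflexiveHom G H f) {a b : V} (h : G.Reachable a b) : H.Reachable (f a) (f b) := by
  obtain ⟨p⟩ := h
  induction p with
  | nil => exact Reachable.refl _
  | cons h _ ih =>
    rcases hf h with h | h
    · rwa [h] at ih
    · exact h.reachable.trans ih

theorem CopsWinFrom.of_retract {V W : Type*} {G : SimpleGraph V} {H : SimpleGraph W}
    {f : V → W} {g : W → V} (hf : IsReflexiveHom G H f) (hg : IsReflexiveHom H G g)
    (hfg : ∀ w, f (g w) = w) {k : ℕ} {c : Fin k → V} {r : V} (h : CopsWinFrom G c r) :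
    ∀ s, r = g s → CopsWinFrom H (f ∘ c) s := by
  induction h with
  | caught c r h =>
    rintro s rfl
    obtain ⟨i, hi⟩ := h
    exact .caught _ _ ⟨i, by simp [hi, hfg]⟩
  | stepCatch c r c' hmove h =>
    rintro s rfl
    obtain ⟨i, hi⟩ := h
    exact .stepCatch _ _ (f ∘ c') (fun j => hf.map_move (hmove j)) ⟨i, by simp [hi, hfg]⟩
  | step c r c' hmove h ih =>
    rintro s rfl
    exact .step _ _ (f ∘ c') (fun j => hf.map_move (hmove j))
      fun s' hs' => ih (g s') (hg.map_move hs') s' rfl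

theorem CopsWin.of_retract {V W : Type*} {G : SimpleGraph V} {H : SimpleGraph W}
    {f : V → W} {g : W → V} (hf : IsReflexiveHom G H f) (hg : IsReflexiveHom H G g)
    (hfg : ∀ w, f (g w) = w) {k : ℕ} (h : CopsWin G k) : CopsWin H k :=
  let ⟨c, hc⟩ := h
  ⟨f ∘ c, fun s => (hc (g s)).of_retract hf hg hfg s rfl⟩

theorem CopsWinFrom.extend {V : Type*} {G : SimpleGraph V} {k m : ℕ} {e : Fin k → Fin m}
    (he : Function.Injective e) {c : Fin k → V} {r : V} (h : CopsWinFrom G c r) (d : Fin m → V) :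
    CopsWinFrom G (Function.extend e c d) r := by
  have hmoves {c c' : Fin k → V} (hmove : ∀ i, c' i = c i ∨ G.Adj (c i) (c' i)) (j : Fin m) :
      Function.extend e c' d j = Function.extend e c d j ∨
        G.Adj (Function.extend e c d j) (Function.extend e c' d j) := by
    by_cases hj : ∃ i, e i = j
    · obtain ⟨i, rfl⟩ := hj
      simpa only [he.extend_apply] using hmove i
    · exact Or.inl (by simp only [Function.extend_apply' _ _ _ hj])
  induction h with
  | caught c r h =>
    obtain ⟨i, hi⟩ := h
    exact .caught _ _ ⟨e i, by rw [he.extend_apply, hi]⟩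
  | stepCatch c r c' hmove h =>
    obtain ⟨i, hi⟩ := h
    exact .stepCatch _ _ _ (hmoves hmove) ⟨e i, by rw [he.extend_apply, hi]⟩
  | step c r c' hmove h ih => exact .step _ _ _ (hmoves hmove) ih

theorem CopsWin.mono {V : Type*} [Nonempty V] {G : SimpleGraph V} {k m : ℕ} (hkm : k ≤ m)
    (h : CopsWin G k) : CopsWin G m :=
  let ⟨_, hc⟩ := h
  ⟨_, fun r => (hc r).extend (Fin.castLE_injective hkm) fun _ => Classical.arbitrary V⟩

theorem copNumber_eq_of_connected {V : Type*} {G : SimpleGraph V} (hG : G.Connected) :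
    copNumber G = copNumberConn G := by
  have hmem (C : G.ConnectedComponent) (v : V) : v ∈ C.supp := by
    induction C using ConnectedComponent.ind with
    | _ w => exact ConnectedComponent.sound (hG.preconnected v w)
  have hC (C : G.ConnectedComponent) : copNumberConn (G.induce C.supp) = copNumberConn G := by
    have hf : IsReflexiveHom (G.induce C.supp) G Subtype.val := fun _ _ h => Or.inr h
    have hg : IsReflexiveHom G (G.induce C.supp) (fun v => ⟨v, hmem C v⟩) :=
      fun _ _ h => Or.inr h
    unfold copNumberConn
    congr 1
    ext k
    exact ⟨fun h => h.of_retract hf hg fun _ => rfl, fun h => h.of_retract hg hf fun _ => rfl⟩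
  have : {n | ∃ C : G.ConnectedComponent, n = copNumberConn (G.induce C.supp)} =
      {copNumberConn G} := by
    ext n
    obtain ⟨v⟩ := hG.nonempty
    simp only [hC, Set.mem_ofPred_eq, Set.mem_singleton_iff]
    exact ⟨fun ⟨_, h⟩ => h, fun h => ⟨G.connectedComponentMk v, h⟩⟩
  rw [copNumber, this, csSup_singleton]

/-- With one cop on, or next to, the vertex cornering the robber, a second cop can walk up to the
robber. -/
theorem IsCorneredBy.copsWinFrom_of_walk {V : Type*} {G : SimpleGraph V} {x u : V}
    (hxu : IsCorneredBy G x u) {k : ℕ} {i j : Fin k} (hij : i ≠ j) {y : V} (p : G.Walk y x) :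
    ∀ d : Fin k → V, (u = d i ∨ G.Adj (d i) u) → d j = y → CopsWinFrom G d x := by
  classical
  induction p with
  | nil => exact fun d _ hj => .caught _ _ ⟨j, hj⟩
  | @cons y w x hyw _ ih =>
    rintro d hi rfl
    have hmove (l : Fin k) : Function.update (Function.update d j w) i u l = d l ∨
        G.Adj (d l) (Function.update (Function.update d j w) i u l) := by
      by_cases hli : l = i
      · subst hli; simpa using hi
      · by_cases hlj : l = j
        · subst hlj; simp [hli, hyw]
        · simp [hli, hlj]
    refine .step _ _ _ hmove ?_
    rintro r (rfl | hr)
    · exact ih hxu _ (by simp) (by simp [hij.symm])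
    · rcases hxu.2 hr with h | h
      · exact .caught _ _ ⟨i, by simp [h]⟩
      · refine .stepCatch _ _ (Function.update (Function.update d j w) i r) (fun l => ?_)
          ⟨i, by simp⟩
        by_cases hli : l = i
        · subst hli; exact Or.inr (by simpa using h)
        · simp [hli]

open Classical in
/-- The retraction of `G` onto `G - x` sending `x` to `u`. -/
noncomputable def cornerRetract {V : Type*} {x u : V} (hux : u ≠ x) (v : V) : ({x}ᶜ : Set V) :=
  if h : v = x then ⟨u, hux⟩ else ⟨v, h⟩

theorem cornerRetract_self {V : Type*} {x u : V} (hux : u ≠ x) :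
    cornerRetract hux x = ⟨u, hux⟩ := by
  simp [cornerRetract]

theorem cornerRetract_of_ne {V : Type*} {x u v : V} (hux : u ≠ x) (h : v ≠ x) :
    cornerRetract hux v = ⟨v, h⟩ := by
  simp [cornerRetract, h]

theorem IsCorneredBy.isReflexiveHom_cornerRetract {V : Type*} {G : SimpleGraph V} {x u : V}
    (hxu : IsCorneredBy G x u) :
    IsReflexiveHom G (G.induce ({x}ᶜ : Set V)) (cornerRetract hxu.1) := by
  intro a b hab
  by_cases ha : a = x
  · subst ha
    rw [cornerRetract_self, cornerRetract_of_ne _ hab.ne']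
    exact (hxu.2 hab).imp (fun h => Subtype.ext h) fun h => h
  · by_cases hb : b = x
    · subst hb
      rw [cornerRetract_self, cornerRetract_of_ne _ ha]
      exact (hxu.2 hab.symm).imp (fun h => Subtype.ext h.symm) fun h => SimpleGraph.Adj.symm (G := G) h
    · rw [cornerRetract_of_ne _ ha, cornerRetract_of_ne _ hb]
      exact Or.inr hab

theorem IsCorneredBy.connected_induce {V : Type*} {G : SimpleGraph V} {x u : V}
    (hxu : IsCorneredBy G x u) (hG : G.Connected) : (G.induce ({x}ᶜ : Set V)).Connected where
  preconnected a b := by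
    have h := hxu.isReflexiveHom_cornerRetract.reachable (hG.preconnected a b)
    rwa [cornerRetract_of_ne _ a.2, cornerRetract_of_ne _ b.2] at h
  nonempty := ⟨⟨u, hxu.1⟩⟩

/-- A cop who can reach the image of the robber under the retraction wins, with the help of a
second cop. -/
theorem IsCorneredBy.copsWinFrom_of_shadow {V : Type*} {G : SimpleGraph V} {x u : V}
    (hxu : IsCorneredBy G x u) (hG : G.Connected) {k : ℕ} (hk : 2 ≤ k) {d : Fin k → V} {r : V}
    {i : Fin k} (hi : (cornerRetract hxu.1 r : V) = d i ∨
      G.Adj (d i) (cornerRetract hxu.1 r)) : CopsWinFrom G d r := by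
  classical
  by_cases hr : r = x
  · subst hr
    rw [cornerRetract_self] at hi
    have : Nontrivial (Fin k) := Fin.nontrivial_iff_two_le.mpr hk
    obtain ⟨j, hj⟩ := exists_ne i
    obtain ⟨p⟩ := hG.preconnected (d j) r
    exact hxu.copsWinFrom_of_walk hj.symm p d hi rfl
  · rw [cornerRetract_of_ne _ hr] at hi
    refine .stepCatch _ _ (Function.update d i r) (fun l => ?_) ⟨i, by simp⟩
    by_cases hli : l = i
    · subst hli; simpa using hi
    · simp [hli]

theorem CopsWinFrom.of_induce_compl_corner {V : Type*} {G : SimpleGraph V} {x u : V}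
    (hxu : IsCorneredBy G x u) (hG : G.Connected) {k : ℕ} (hk : 2 ≤ k)
    {c : Fin k → ({x}ᶜ : Set V)} {s : ({x}ᶜ : Set V)}
    (h : CopsWinFrom (G.induce ({x}ᶜ : Set V)) c s) :
    ∀ r, s = cornerRetract hxu.1 r → CopsWinFrom G (fun i => (c i : V)) r := by
  have hf := hxu.isReflexiveHom_cornerRetract
  have hg : IsReflexiveHom (G.induce ({x}ᶜ : Set V)) G Subtype.val := fun _ _ h => Or.inr h
  induction h with
  | caught c s h =>
    rintro r rfl
    obtain ⟨i, hi⟩ := h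
    exact hxu.copsWinFrom_of_shadow hG hk (i := i) (Or.inl (by rw [hi]))
  | stepCatch c s c' hmove h =>
    rintro r rfl
    obtain ⟨i, hi⟩ := h
    refine .step _ _ (fun i => (c' i : V)) (fun j => hg.map_move (hmove j)) fun r' hr' => ?_
    refine hxu.copsWinFrom_of_shadow hG hk (i := i) ?_
    rw [hi]
    exact hg.map_move (hf.map_move hr')
  | step c s c' hmove h ih =>
    rintro r rfl
    exact .step _ _ (fun i => (c' i : V)) (fun j => hg.map_move (hmove j))
      fun r' hr' => ih _ (hf.map_move hr') r' rfl

theorem CopsWin.of_induce_compl_corner {V : Type*} {G : SimpleGraph V} {x u : V}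
    (hxu : IsCorneredBy G x u) (hG : G.Connected) {k : ℕ} (hk : 2 ≤ k)
    (h : CopsWin (G.induce ({x}ᶜ : Set V)) k) : CopsWin G k :=
  let ⟨_, hc⟩ := h
  ⟨_, fun r => (hc _).of_induce_compl_corner hxu hG hk r rfl⟩

theorem CopsWin.induce_compl_corner {V : Type*} {G : SimpleGraph V} {x u : V}
    (hxu : IsCorneredBy G x u) {k : ℕ} (h : CopsWin G k) :
    CopsWin (G.induce ({x}ᶜ : Set V)) k :=
  h.of_retract hxu.isReflexiveHom_cornerRetract (g := Subtype.val) (fun _ _ h => Or.inr h)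
    fun w => cornerRetract_of_ne _ w.2

/-- If `x` is a corner of a finite connected graph `G`, then
`c(G - x) ≥ 2` implies `c(G) = c(G - x)`, and `c(G - x) = 1` implies `c(G) ∈ {1, 2}`. -/
theorem copNumber_remove_corner {V : Type*} [Fintype V] (G : SimpleGraph V)
    (hG : G.Connected) (x : V) (hx : IsCornerVertex G x) :
    (2 ≤ copNumber (G.induce ({x}ᶜ : Set V)) →
      copNumber G = copNumber (G.induce ({x}ᶜ : Set V))) ∧
    (copNumber (G.induce ({x}ᶜ : Set V)) = 1 →
      copNumber G = 1 ∨ copNumber G = 2) := by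
  obtain ⟨u, hxu⟩ := hx
  have hH := hxu.connected_induce hG
  rw [copNumber_eq_of_connected hG, copNumber_eq_of_connected hH]
  have := hH.nonempty
  have hwin (h : 1 ≤ copNumberConn (G.induce ({x}ᶜ : Set V))) :
      CopsWin (G.induce ({x}ᶜ : Set V)) (copNumberConn (G.induce ({x}ᶜ : Set V))) :=
    Nat.sInf_mem (Nat.nonempty_of_pos_sInf h)
  have hle {k : ℕ} (h : CopsWin G k) :
      copNumberConn (G.induce ({x}ᶜ : Set V)) ≤ copNumberConn G :=
    Nat.sInf_le ((Nat.sInf_mem (s := {k | CopsWin G k}) ⟨k, h⟩).induce_compl_corner hxu)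
  constructor
  · intro h
    have hw := (hwin (by omega)).of_induce_compl_corner hxu hG h
    exact le_antisymm (Nat.sInf_le hw) (hle hw)
  · intro h
    have hw := ((hwin h.ge).mono (show _ ≤ 2 by omega)).of_induce_compl_corner hxu hG le_rfl
    have h2 : copNumberConn G ≤ 2 := Nat.sInf_le hw
    have h1 := hle hw
    omega
end

section
/- If G is a finite connected simple graph on n vertices whose maximum degree Δ satisfies Δ > n − 11, then c(G) ≤ 3. -/
open SimpleGraph

section Game

variable {V W : Type*} {G : SimpleGraph V} {H : SimpleGraph W}

theorem CopsWinFrom.map_iso {k : ℕ} (e : G ≃g H) {c : Fin k → V} {r : V}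
    (h : CopsWinFrom G c r) : CopsWinFrom H (fun i => e (c i)) (e r) := by
  have move (c c' : Fin k → V) (hm : ∀ i, c' i = c i ∨ G.Adj (c i) (c' i)) (i : Fin k) :
      e (c' i) = e (c i) ∨ H.Adj (e (c i)) (e (c' i)) :=
    (hm i).imp (congrArg e) e.map_adj_iff.2
  induction h with
  | caught c r h => exact .caught _ _ (h.imp fun i hi => congrArg e hi)
  | stepCatch c r c' hm h =>
    exact .stepCatch _ _ _ (move c c' hm) (h.imp fun i hi => congrArg e hi)
  | step c r c' hm _ ih =>
    refine .step _ _ _ (move c c' hm) fun r' hr' => ?_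
    obtain ⟨s, rfl⟩ := e.surjective r'
    exact ih s (hr'.imp (fun h => e.injective h) e.map_adj_iff.1)

theorem CopsWin.of_iso {k : ℕ} (e : G ≃g H) (h : CopsWin G k) : CopsWin H k := by
  obtain ⟨c, hc⟩ := h
  refine ⟨fun i => e (c i), fun r => ?_⟩
  obtain ⟨s, rfl⟩ := e.surjective r
  exact (hc s).map_iso e

theorem CopsWinFrom.of_adj {k : ℕ} {c : Fin k → V} {r : V} (i : Fin k)
    (h : c i = r ∨ G.Adj (c i) r) : CopsWinFrom G c r := by
  refine .stepCatch c r (Function.update c i r) (fun j => ?_) ⟨i, by simp⟩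
  rcases eq_or_ne j i with rfl | hj
  · simpa [eq_comm] using h
  · simp [hj]

/-- If a cop guarding `v` confines the robber to the image of `H`, then `k` further cops who
win on `H` also win on `G`. -/
theorem CopsWinFrom.lift {k : ℕ} (f : W → V) (v : V)
    (hf : ∀ a b, H.Adj a b → G.Adj (f a) (f b))
    (hconf : ∀ a t, G.Adj (f a) t → (∃ b, t = f b ∧ H.Adj a b) ∨ G.Adj v t)
    {c : Fin k → W} {r : W} (h : CopsWinFrom H c r) :
    CopsWinFrom G (Fin.cons v (fun i => f (c i)) : Fin (k + 1) → V) (f r) := by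
  have move (c c' : Fin k → W) (hm : ∀ i, c' i = c i ∨ H.Adj (c i) (c' i)) (i : Fin (k + 1)) :
      (Fin.cons v (fun i => f (c' i)) : Fin (k + 1) → V) i =
        (Fin.cons v (fun i => f (c i)) : Fin (k + 1) → V) i ∨
      G.Adj ((Fin.cons v (fun i => f (c i)) : Fin (k + 1) → V) i)
        ((Fin.cons v (fun i => f (c' i)) : Fin (k + 1) → V) i) := by
    refine Fin.cases (by simp) (fun j => ?_) i
    simpa using (hm j).imp (congrArg f) (hf _ _)
  induction h with
  | caught c r h =>
    obtain ⟨i, hi⟩ := h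
    exact .caught _ _ ⟨i.succ, by simp [hi]⟩
  | stepCatch c r c' hm h =>
    obtain ⟨i, hi⟩ := h
    exact .stepCatch _ _ _ (move c c' hm) ⟨i.succ, by simp [hi]⟩
  | step c r c' hm _ ih =>
    refine .step _ _ _ (move c c' hm) fun r' hr' => ?_
    rcases hr' with rfl | hr'
    · exact ih r (.inl rfl)
    · rcases hconf r r' hr' with ⟨b, rfl, hb⟩ | hv
      · exact ih b (.inr hb)
      · exact .of_adj 0 (.inr (by simpa using hv))

/-- While the cop `j` confines the robber to `S`, another cop can walk to any vertex. -/
theorem CopsWinFrom.of_walk {k : ℕ} {S : Set V} {i j : Fin k} (hij : j ≠ i) {v s t : V}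
    (hconf : ∀ r ∈ S, ∀ r', G.Adj r r' → r' ∈ S ∨ G.Adj v r') (w : G.Walk s t) :
    ∀ c : Fin k → V, c j = v → c i = s →
      (∀ r ∈ S, CopsWinFrom G (Function.update c i t) r) → ∀ r ∈ S, CopsWinFrom G c r := by
  induction w with
  | nil =>
    intro c _ hs h r hr
    simpa [← hs] using h r hr
  | @cons s s' t hadj w ih =>
    intro c hv hs h r hr
    have key := ih (Function.update c i s') (by simp [hij, hv]) (by simp) (by simpa using h)
    refine .step _ _ (Function.update c i s') (fun l => ?_) fun r' hr' => ?_
    · rcases eq_or_ne l i with rfl | hl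
      · simp [hs, hadj]
      · simp [hl]
    · rcases hr' with rfl | hr'
      · exact key r' hr
      · rcases hconf r hr r' hr' with h' | h'
        · exact key r' h'
        · exact .of_adj j (.inr (by simpa [hij, hv] using h'))

/-- Adding a cop at a vertex `v`: if two cops win on every connected graph with at most `m`
vertices, three cops win on every connected graph where some `v` has at most `m` non-neighbours. -/
theorem CopsWin.three_of_two.{u} {V : Type u} [Fintype V] {G : SimpleGraph V}
    (hG : G.Connected) (m : ℕ) (v : V)
    (hcard : Nat.card {w // w ≠ v ∧ ¬ G.Adj v w} ≤ m)
    (htwo : ∀ (W : Type u) [Fintype W] (H : SimpleGraph W), H.Connected →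
      Fintype.card W ≤ m → CopsWin H 2) : CopsWin G 3 := by
  classical
  refine ⟨fun _ => v, fun r => ?_⟩
  by_cases hr : r ≠ v ∧ ¬ G.Adj v r
  swap
  · exact .of_adj 0 (by tauto)
  let U : Set V := {w | w ≠ v ∧ ¬ G.Adj v w}
  let C := (G.induce U).connectedComponentMk ⟨r, hr⟩
  let f : C → V := fun a => a.1.1
  have hf : ∀ a b, C.toSimpleGraph.Adj a b → G.Adj (f a) (f b) := fun a b h => h
  have hconf : ∀ a t, G.Adj (f a) t → (∃ b, t = f b ∧ C.toSimpleGraph.Adj a b) ∨ G.Adj v t := by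
    intro a t hat
    by_cases hvt : G.Adj v t
    · exact .inr hvt
    have htv : t ≠ v := by
      rintro rfl
      exact a.1.2.2 hat.symm
    have hadj : (G.induce U).Adj a.1 ⟨t, htv, hvt⟩ := hat
    exact .inl ⟨⟨⟨t, htv, hvt⟩, C.mem_supp_of_adj_mem_supp a.2 hadj⟩, rfl, hat⟩
  have hC : CopsWin C.toSimpleGraph 2 := by
    refine htwo _ _ C.connected_toSimpleGraph (le_trans ?_ hcard)
    rw [← Nat.card_eq_fintype_card]
    exact Nat.card_le_card_of_injective (fun a : C => a.1) Subtype.val_injective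
  obtain ⟨d, hd⟩ := hC
  have hconf' : ∀ s ∈ Set.range f, ∀ s', G.Adj s s' → s' ∈ Set.range f ∨ G.Adj v s' := by
    rintro _ ⟨a, rfl⟩ s' hs'
    exact (hconf a s' hs').imp_left fun ⟨b, hb, _⟩ => ⟨b, hb.symm⟩
  have hwin : ∀ s ∈ Set.range f,
      CopsWinFrom G (Fin.cons v (fun i => f (d i)) : Fin 3 → V) s := by
    rintro _ ⟨a, rfl⟩
    exact (hd a).lift f v hf hconf
  obtain ⟨w₁⟩ := hG.preconnected v (f (d 0))
  obtain ⟨w₂⟩ := hG.preconnected v (f (d 1))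
  refine CopsWinFrom.of_walk (i := 1) (j := 0) (by decide) hconf' w₁ _ rfl rfl ?_ r
    ⟨⟨⟨r, hr⟩, rfl⟩, rfl⟩
  refine CopsWinFrom.of_walk (i := 2) (j := 0) (by decide) hconf' w₂ _ (by simp) (by simp) ?_
  convert hwin using 3
  funext i
  fin_cases i <;> rfl

end Game

section Dismantling

variable {V : Type*} {G : SimpleGraph V}

/-- `x` is not isolated in `G[T]`, and no other vertex of `T` dominates it there. -/
def IsStuck (G : SimpleGraph V) (T : Finset V) (x : V) : Prop :=
  (∃ y ∈ T, G.Adj x y) ∧ ∀ y ∈ T, G.Adj x y → ∃ z ∈ T, G.Adj x z ∧ z ≠ y ∧ ¬ G.Adj y z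

/-- `S` can be emptied by repeatedly deleting isolated or dominated vertices. -/
inductive Dismantlable [DecidableEq V] (G : SimpleGraph V) : Finset V → Prop
  | empty : Dismantlable G ∅
  | remove (S : Finset V) (x : V) (hx : x ∈ S) (h : ¬ IsStuck G S x)
      (hS : Dismantlable G (S.erase x)) : Dismantlable G S

/-- A single cop at `q`, with the move, catches a robber at `r` who never leaves `S`. -/
inductive ChaseWin (G : SimpleGraph V) (S : Finset V) : V → V → Prop
  | near (q r : V) (h : q = r ∨ G.Adj q r) : ChaseWin G S q r
  | step (q r q' : V) (hq : q' = q ∨ G.Adj q q')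
      (h : ∀ r' ∈ S, (r' = r ∨ G.Adj r r') → ChaseWin G S q' r') : ChaseWin G S q r

theorem ChaseWin.of_isolated [DecidableEq V] {S : Finset V} {x : V}
    (hx : ∀ y ∈ S, ¬ G.Adj x y) {q r : V} (h : ChaseWin G (S.erase x) q r)
    (hr : r ∈ S.erase x) : ChaseWin G S q r := by
  induction h with
  | near q r h => exact .near q r h
  | step q r q' hq _ ih =>
    refine .step q r q' hq fun r' hr' hmove => ?_
    have : r' ∈ S.erase x := by
      refine Finset.mem_erase.2 ⟨?_, hr'⟩
      rintro rfl
      rcases hmove with rfl | hmove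
      · simp at hr
      · exact hx r (Finset.mem_of_mem_erase hr) hmove.symm
    exact ih r' this hmove this

theorem ChaseWin.of_isolated_walk {S : Finset V} {q x : V} (hx : ∀ y ∈ S, ¬ G.Adj x y)
    (w : G.Walk q x) : ChaseWin G S q x := by
  induction w with
  | nil => exact .near _ _ (.inl rfl)
  | cons hadj w ih =>
    refine .step _ _ _ (.inr hadj) fun r' hr' hmove => ?_
    rcases hmove with rfl | hmove
    · exact ih hx
    · exact absurd hmove (hx r' hr')

theorem ChaseWin.of_dominated [DecidableEq V] {S : Finset V} {x y : V} (hyS : y ∈ S)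
    (hxy : G.Adj x y) (hdom : ∀ z ∈ S, G.Adj x z → z = y ∨ G.Adj y z) {q s : V}
    (h : ChaseWin G (S.erase x) q s) :
    ∀ r ∈ S, (if r = x then y else r) = s → ChaseWin G S q r := by
  induction h with
  | near q s h =>
    intro r hr hrs
    by_cases hrx : r = x
    · subst hrx
      simp only [if_true] at hrs
      subst hrs
      refine .step q r y (h.imp_left Eq.symm) fun r' hr' hmove => .near _ _ ?_
      rcases hmove with rfl | hmove
      · exact .inr hxy.symm
      · exact (hdom r' hr' hmove).imp_left Eq.symm
    · simp only [hrx, if_false] at hrs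
      exact .near q r (hrs ▸ h)
  | step q s q' hq _ ih =>
    intro r hr hrs
    refine .step q r q' hq fun r' hr' hmove => ih _ ?_ ?_ r' hr' rfl
    · have := hxy.ne'
      split_ifs <;> simp_all
    · subst hrs
      have := hxy
      split_ifs with h1 h2 h2
      · exact .inl rfl
      · subst h1
        rcases hmove with hmove | hmove
        · exact absurd hmove.symm h2
        · exact (hdom r hr hmove.symm).imp Eq.symm SimpleGraph.Adj.symm
      · subst h2
        exact hdom r' hr' (hmove.resolve_left h1)
      · exact hmove

theorem Dismantlable.chaseWin [DecidableEq V] (hG : G.Connected) {S : Finset V}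
    (hS : Dismantlable G S) : ∀ q, ∀ r ∈ S, ChaseWin G S q r := by
  induction hS with
  | empty => simp
  | remove S x hx h _ ih =>
    intro q r hr
    by_cases hiso : ∀ y ∈ S, ¬ G.Adj x y
    · rcases eq_or_ne r x with rfl | hrx
      · obtain ⟨w⟩ := hG.preconnected q r
        exact .of_isolated_walk hiso w
      · have hr' := Finset.mem_erase.2 ⟨hrx, hr⟩
        exact (ih q r hr').of_isolated hiso hr'
    · push Not at hiso
      obtain ⟨y, hyS, hxy, hdom⟩ : ∃ y ∈ S, G.Adj x y ∧
          ∀ z ∈ S, G.Adj x z → z = y ∨ G.Adj y z := by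
        by_contra! hcon
        exact h ⟨hiso, fun y hy hxy => by simpa using hcon y hy hxy⟩
      refine (ih q _ ?_).of_dominated hyS hxy hdom r hr rfl
      have := hxy.ne'
      split_ifs <;> simp_all

theorem CopsWinFrom.of_chaseWin {S : Finset V} {p : V}
    (hconf : ∀ t, t ∈ S ∨ p = t ∨ G.Adj p t) {q r : V} (h : ChaseWin G S q r) :
    CopsWinFrom G ![p, q] r := by
  induction h with
  | near q r h => exact .of_adj 1 h
  | step q r q' hq _ ih =>
    refine .step _ _ ![p, q'] (by simpa [Fin.forall_fin_two] using hq) fun r' hr' => ?_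
    rcases hconf r' with h | h
    · exact ih r' h hr'
    · exact .of_adj 0 h

/-- If the non-neighbours of some vertex `p` can be dismantled, two cops win. -/
theorem CopsWin.of_dismantlable [DecidableEq V] (hG : G.Connected) {S : Finset V} (p : V)
    (hconf : ∀ t, t ∈ S ∨ p = t ∨ G.Adj p t) (hS : Dismantlable G S) : CopsWin G 2 := by
  refine ⟨![p, p], fun r => ?_⟩
  rcases hconf r with h | h
  · exact .of_chaseWin hconf (hS.chaseWin hG p r h)
  · exact .of_adj 0 h

theorem exists_stuck_of_not_dismantlable [DecidableEq V] {S K : Finset V} (hK : K ⊆ S)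
    (hS : ¬ Dismantlable G S) :
    ∃ T, K ⊆ T ∧ T ⊆ S ∧ ¬ Dismantlable G T ∧ ∀ x ∈ T, x ∉ K → IsStuck G T x := by
  induction S using Finset.strongInduction with
  | H S ih =>
    by_cases hst : ∀ x ∈ S, x ∉ K → IsStuck G S x
    · exact ⟨S, hK, subset_rfl, hS, hst⟩
    · push Not at hst
      obtain ⟨x, hx, hxK, hn⟩ := hst
      have hsub : K ⊆ S.erase x := fun a ha =>
        Finset.mem_erase.2 ⟨fun h => hxK (h ▸ ha), hK ha⟩
      obtain ⟨T, h1, h2, h3⟩ := ih _ (Finset.erase_ssubset hx) hsub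
        fun h => hS (.remove S x hx hn h)
      exact ⟨T, h1, h2.trans (Finset.erase_subset _ _), h3⟩

end Dismantling

section StuckSets

variable {V : Type*} {G : SimpleGraph V}

/-- A nonempty set in which no vertex is isolated or dominated by another one. -/
def IsStuckSet (G : SimpleGraph V) (T : Finset V) : Prop :=
  T.Nonempty ∧ ∀ x ∈ T, IsStuck G T x

/-- `a b c d` is an induced 4-cycle. -/
def IsInducedFourCycle (G : SimpleGraph V) (a b c d : V) : Prop :=
  (G.Adj a b ∧ G.Adj b c ∧ G.Adj c d ∧ G.Adj d a) ∧ (a ≠ c ∧ b ≠ d) ∧ ¬ G.Adj a c ∧ ¬ G.Adj b d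

/-- `a b c d e` is an induced 5-cycle. -/
def IsInducedFiveCycle (G : SimpleGraph V) (a b c d e : V) : Prop :=
  (G.Adj a b ∧ G.Adj b c ∧ G.Adj c d ∧ G.Adj d e ∧ G.Adj e a) ∧
  (¬ G.Adj a c ∧ ¬ G.Adj b d ∧ ¬ G.Adj c e ∧ ¬ G.Adj d a ∧ ¬ G.Adj e b)

theorem IsInducedFourCycle.rotate {a b c d : V} (h : IsInducedFourCycle G a b c d) :
    IsInducedFourCycle G b c d a := by
  simp only [IsInducedFourCycle, ne_eq, G.adj_comm c a, G.adj_comm b d] at h ⊢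
  tauto

theorem IsInducedFiveCycle.rotate {a b c d e : V} (h : IsInducedFiveCycle G a b c d e) :
    IsInducedFiveCycle G b c d e a := by
  simp only [IsInducedFiveCycle] at h ⊢
  tauto

/-- A stuck vertex has two non-adjacent neighbours. -/
theorem IsStuck.exists_pair {T : Finset V} {x : V} (h : IsStuck G T x) :
    ∃ y ∈ T, ∃ z ∈ T, G.Adj x y ∧ G.Adj x z ∧ z ≠ y ∧ ¬ G.Adj y z := by
  obtain ⟨⟨y, hy, hxy⟩, h⟩ := h
  obtain ⟨z, hz, h⟩ := h y hy hxy
  exact ⟨y, hy, z, hz, hxy, h⟩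

/-- The induced path on four vertices found in every stuck set, with a second
neighbour `t` of its last vertex. -/
theorem IsStuckSet.exists_path [DecidableEq V] {T : Finset V} (hT : IsStuckSet G T) :
    ∃ x ∈ T, ∃ y ∈ T, ∃ z ∈ T, ∃ w ∈ T, ∃ t ∈ T,
      G.Adj x y ∧ G.Adj x z ∧ z ≠ y ∧ ¬ G.Adj y z ∧ G.Adj y w ∧ w ≠ x ∧ ¬ G.Adj x w ∧
      G.Adj z t ∧ t ≠ x ∧ ¬ G.Adj x t := by
  obtain ⟨⟨x, hx⟩, h⟩ := hT
  obtain ⟨y, hy, z, hz, hxy, hxz, hzy, hyz⟩ := (h x hx).exists_pair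
  obtain ⟨w, hw, h1⟩ := (h y hy).2 x hx hxy.symm
  obtain ⟨t, ht, h2⟩ := (h z hz).2 x hx hxz.symm
  exact ⟨x, hx, y, hy, z, hz, w, hw, t, ht, hxy, hxz, hzy, hyz, h1.1, h1.2.1, h1.2.2, h2⟩

theorem IsStuckSet.four_le_card [DecidableEq V] {T : Finset V} (hT : IsStuckSet G T) :
    4 ≤ T.card := by
  obtain ⟨x, hx, y, hy, z, hz, w, hw, t, ht, h⟩ := hT.exists_path
  have hsub : ({x, y, z, w} : Finset V) ⊆ T := by grind
  have hc : ({x, y, z, w} : Finset V).card = 4 := by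
    have := h.1.ne
    have := h.2.1.ne
    have := h.2.2.2.2.1.ne
    have : z ≠ w := by grind
    grind
  exact hc ▸ Finset.card_le_card hsub

theorem IsStuckSet.eq_fourCycle [DecidableEq V] {T : Finset V} (hT : IsStuckSet G T)
    (hcard : T.card ≤ 4) :
    ∃ a b c d, IsInducedFourCycle G a b c d ∧ T = {a, b, c, d} := by
  obtain ⟨x, hx, y, hy, z, hz, w, hw, t, ht, h⟩ := hT.exists_path
  have hsub : ({x, y, w, z} : Finset V) ⊆ T := by grind
  have hc : ({x, y, w, z} : Finset V).card = 4 := by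
    have := h.1.ne
    have := h.2.1.ne
    have := h.2.2.2.2.1.ne
    have : z ≠ w := by grind
    grind
  have hTe := (Finset.eq_of_subset_of_card_le hsub (hc ▸ hcard)).symm
  refine ⟨x, y, w, z, ?_, hTe⟩
  have : t = w := by
    rw [hTe] at ht
    grind [SimpleGraph.irrefl]
  subst this
  obtain ⟨h1, h2, h3, h4, h5, h6, h7, h8, -⟩ := h
  exact ⟨⟨h1, h5, h8.symm, h2.symm⟩, ⟨h6.symm, h3.symm⟩, h7, h4⟩

theorem IsStuckSet.eq_fiveCycle [DecidableEq V] {T : Finset V} (hT : IsStuckSet G T)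
    (hfour : ∀ a b c d, ¬ IsInducedFourCycle G a b c d) (hcard : T.card ≤ 5) :
    T.card = 5 ∧ ∃ a b c d e, IsInducedFiveCycle G a b c d e ∧ T = {a, b, c, d, e} := by
  obtain ⟨x, hx, y, hy, z, hz, w, hw, t, ht, h1, h2, h3, h4, h5, h6, h7, h8, h9, h10⟩ :=
    hT.exists_path
  have hzw : ¬ G.Adj z w := fun h =>
    hfour x y w z ⟨⟨h1, h5, h.symm, h2.symm⟩, ⟨h6.symm, h3.symm⟩, h7, h4⟩
  have hyt : ¬ G.Adj y t := fun h =>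
    hfour x y t z ⟨⟨h1, h, h8.symm, h2.symm⟩, ⟨h9.symm, h3.symm⟩, h10, h4⟩
  have hsub : ({x, y, w, t, z} : Finset V) ⊆ T := by grind
  have hc : ({x, y, w, t, z} : Finset V).card = 5 := by
    have := h1.ne
    have := h2.ne
    have := h5.ne
    have := h8.ne
    have : z ≠ w := by grind
    have : y ≠ t := by grind
    have : w ≠ t := by grind
    grind
  have hTe := (Finset.eq_of_subset_of_card_le hsub (hc ▸ hcard)).symm
  refine ⟨hTe ▸ hc, x, y, w, t, z, ?_, hTe⟩
  obtain ⟨s, hs, h11, h12, h13⟩ := (hT.2 w hw).2 y hy h5.symm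
  have hst : s = t := by
    rw [hTe] at hs
    grind [SimpleGraph.irrefl, SimpleGraph.adj_comm]
  subst hst
  exact ⟨⟨h1, h5, h11, h8.symm, h2.symm⟩, h7, hyt, fun h => hzw h.symm,
    fun h => h10 h.symm, fun h => h4 h.symm⟩

theorem exists_adj_boundary (hG : G.Connected) {S : Finset V} {x y : V} (hx : x ∈ S)
    (hy : y ∉ S) : ∃ s ∈ S, ∃ t ∉ S, G.Adj s t := by
  obtain ⟨w⟩ := hG.preconnected x y
  obtain ⟨d, -, h1, h2⟩ := w.exists_boundary_dart (S : Set V) hx hy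
  exact ⟨d.fst, h1, d.snd, h2, d.adj⟩

end StuckSets

section SmallDegree

variable {V : Type*} {G : SimpleGraph V} [DecidableEq V]

theorem eq_of_adj_of_card_le {v a b c d : V}
    (hdeg : ∀ s : Finset V, (∀ x ∈ s, G.Adj v x) → s.card ≤ 3) (ha : G.Adj v a)
    (hb : G.Adj v b) (hc : G.Adj v c) (hd : G.Adj v d) (hab : a ≠ b) (hac : a ≠ c)
    (hbc : b ≠ c) : d = a ∨ d = b ∨ d = c := by
  by_contra! h
  have := hdeg {a, b, c, d} (by grind)
  grind

/-- In a stuck set of a subcubic graph every vertex has at most one neighbour outside. -/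
theorem IsStuckSet.notMem {T : Finset V} (hT : IsStuckSet G T)
    (hdeg : ∀ v, ∀ s : Finset V, (∀ x ∈ s, G.Adj v x) → s.card ≤ 3) {x m n : V}
    (hm : G.Adj x m) (hn : G.Adj x n) (hmn : m ≠ n) (hmT : m ∉ T) (hnT : n ∉ T) : x ∉ T := by
  intro hx
  obtain ⟨y, hy, z, hz, hxy, hxz, hzy, -⟩ := (hT.2 x hx).exists_pair
  have := eq_of_adj_of_card_le (hdeg x) hm hn hxy hxz hmn (by grind) (by grind)
  grind

variable [Fintype V]

theorem stuck_compl_of_fourCycle (hV : Fintype.card V ≤ 9)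
    (hdeg : ∀ v, ∀ s : Finset V, (∀ x ∈ s, G.Adj v x) → s.card ≤ 3)
    (hst : ∀ p, ∃ T, IsStuckSet G T ∧ ∀ t ∈ T, t ≠ p ∧ ¬ G.Adj p t) {a b c d e : V}
    (h : IsInducedFourCycle G a b c d) (he : G.Adj a e) (heb : e ≠ b) (hed : e ≠ d) :
    IsStuckSet G ({a, b, c, d, e}ᶜ) ∧ (({a, b, c, d, e} : Finset V)ᶜ).card ≤ 4 := by
  obtain ⟨⟨hab, hbc, hcd, hda⟩, ⟨hac, hbd⟩, nac, nbd⟩ := h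
  obtain ⟨T, hT, hTa⟩ := hst a
  have hbT : b ∉ T := fun hb => (hTa b hb).2 hab
  have hdT : d ∉ T := fun hd => (hTa d hd).2 hda.symm
  have heT : e ∉ T := fun hd => (hTa e hd).2 he
  have haT : a ∉ T := fun ha => (hTa a ha).1 rfl
  have hcT : c ∉ T := hT.notMem hdeg hbc.symm hcd hbd hbT hdT
  have hsub : T ⊆ ({a, b, c, d, e} : Finset V)ᶜ := by
    intro t ht
    simp only [Finset.mem_compl, Finset.mem_insert, Finset.mem_singleton]
    grind
  have h5 : ({a, b, c, d, e} : Finset V).card = 5 := by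
    have := hab.ne
    have := hbc.ne
    have := hcd.ne
    have := hda.ne
    have := he.ne
    have : c ≠ e := by grind
    grind
  have h4 : (({a, b, c, d, e} : Finset V)ᶜ).card ≤ 4 := by
    rw [Finset.card_compl, h5]
    omega
  have heq := Finset.eq_of_subset_of_card_le hsub (h4.trans hT.four_le_card)
  exact ⟨heq ▸ hT, h4⟩

theorem stuck_compl_of_fourCycle_of_mem (hV : Fintype.card V ≤ 9)
    (hdeg : ∀ v, ∀ s : Finset V, (∀ x ∈ s, G.Adj v x) → s.card ≤ 3)
    (hst : ∀ p, ∃ T, IsStuckSet G T ∧ ∀ t ∈ T, t ≠ p ∧ ¬ G.Adj p t) {a b c d s e : V}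
    (h : IsInducedFourCycle G a b c d) (hs : s ∈ ({a, b, c, d} : Finset V))
    (he : e ∉ ({a, b, c, d} : Finset V)) (hse : G.Adj s e) :
    IsStuckSet G ({a, b, c, d, e}ᶜ) := by
  simp only [Finset.mem_insert, Finset.mem_singleton] at hs he
  rcases hs with rfl | rfl | rfl | rfl
  · exact (stuck_compl_of_fourCycle hV hdeg hst h hse (by tauto) (by tauto)).1
  · convert (stuck_compl_of_fourCycle hV hdeg hst h.rotate hse (by tauto) (by tauto)).1 using 2
    grind
  · convert (stuck_compl_of_fourCycle hV hdeg hst h.rotate.rotate hse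
      (by tauto) (by tauto)).1 using 2
    grind
  · convert (stuck_compl_of_fourCycle hV hdeg hst h.rotate.rotate.rotate hse
      (by tauto) (by tauto)).1 using 2
    grind

theorem mem_compl_insert_four {a b c d t v : V} :
    v ∈ ({a, b, c, d, t} : Finset V)ᶜ ↔ v ∉ ({a, b, c, d} : Finset V) ∧ v ≠ t := by
  simp only [Finset.mem_compl, Finset.mem_insert, Finset.mem_singleton]
  tauto

/-- An edge between two disjoint 4-cycles that are also joined through the remaining
vertex `x` is impossible. -/
theorem not_adj_of_linked_fourCycles (hV : Fintype.card V ≤ 9)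
    (hdeg : ∀ v, ∀ s : Finset V, (∀ x ∈ s, G.Adj v x) → s.card ≤ 3)
    (hst : ∀ p, ∃ T, IsStuckSet G T ∧ ∀ t ∈ T, t ≠ p ∧ ¬ G.Adj p t) {a b c d x e f g h : V}
    (h₁ : IsInducedFourCycle G a b c d) (h₂ : IsInducedFourCycle G e f g h)
    (hax : G.Adj a x) (hex : G.Adj e x) (hx : x ∉ ({a, b, c, d} : Finset V))
    (hcompl : ({a, b, c, d, x} : Finset V)ᶜ = {e, f, g, h}) {s t : V}
    (hs : s ∈ ({b, c, d} : Finset V)) (ht : t ∈ ({f, g, h} : Finset V)) : ¬ G.Adj s t := by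
  intro hadj
  have hmem (v : V) : v ∈ ({e, f, g, h} : Finset V) ↔ v ∉ ({a, b, c, d} : Finset V) ∧ v ≠ x :=
    hcompl ▸ mem_compl_insert_four
  have ht' := (hmem t).1 (Finset.mem_insert_of_mem ht)
  have he' := (hmem e).1 (Finset.mem_insert_self _ _)
  have key := stuck_compl_of_fourCycle_of_mem hV hdeg hst h₁ (Finset.mem_insert_of_mem hs)
    ht'.1 hadj
  obtain ⟨⟨hef, hfg, hgh, hhe⟩, ⟨heg, hfh⟩, neg, nfh⟩ := h₂
  have het : e ≠ t := by
    simp only [Finset.mem_insert, Finset.mem_singleton] at ht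
    rcases ht with rfl | rfl | rfl
    exacts [hef.ne, heg, hhe.ne']
  obtain ⟨z, hz, hxz, hze, nez⟩ := (key.2 x (mem_compl_insert_four.2 ⟨hx, ht'.2.symm⟩)).2 e
    (mem_compl_insert_four.2 ⟨he'.1, het⟩) hex.symm
  have hxg : G.Adj x g := by
    have hz' := (hmem z).2 ⟨(mem_compl_insert_four.1 hz).1, hxz.ne'⟩
    simp only [Finset.mem_insert, Finset.mem_singleton] at hz'
    rcases hz' with rfl | rfl | rfl | rfl
    exacts [absurd rfl hze, absurd hef nez, hxz, absurd hhe.symm nez]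
  obtain ⟨T, hT, hTx⟩ := hst x
  have haT : a ∉ T := fun h => (hTx a h).2 hax.symm
  have heT : e ∉ T := fun h => (hTx e h).2 hex.symm
  have hgT : g ∉ T := fun h => (hTx g h).2 hxg
  have hfT : f ∉ T := hT.notMem hdeg hef.symm hfg heg heT hgT
  have hhT : h ∉ T := hT.notMem hdeg hhe hgh.symm heg heT hgT
  have hsub : T ⊆ {b, c, d} := by
    intro v hv
    by_contra hcon
    have hv4 : v ∉ ({a, b, c, d} : Finset V) :=
      Finset.mem_insert.not.2 (not_or.2 ⟨fun h => haT (h ▸ hv), hcon⟩)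
    have := (hmem v).2 ⟨hv4, (hTx v hv).1⟩
    simp only [Finset.mem_insert, Finset.mem_singleton] at this
    rcases this with rfl | rfl | rfl | rfl <;> contradiction
  have := Finset.card_le_card hsub
  have := hT.four_le_card
  have := Finset.card_le_three (a := b) (b := c) (c := d)
  omega

/-- The main case of `false_of_fourCycle`: the two disjoint 4-cycles are joined through
the remaining vertex `x`. -/
theorem false_of_linked_fourCycles (hV : Fintype.card V ≤ 9)
    (hdeg : ∀ v, ∀ s : Finset V, (∀ x ∈ s, G.Adj v x) → s.card ≤ 3)
    (hst : ∀ p, ∃ T, IsStuckSet G T ∧ ∀ t ∈ T, t ≠ p ∧ ¬ G.Adj p t) {a b c d x e f g h : V}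
    (h₁ : IsInducedFourCycle G a b c d) (h₂ : IsInducedFourCycle G e f g h)
    (hax : G.Adj a x) (hex : G.Adj e x) (hx : x ∉ ({a, b, c, d} : Finset V))
    (hcompl : ({a, b, c, d, x} : Finset V)ᶜ = {e, f, g, h}) : False := by
  have hcross : ∀ s ∈ ({b, c, d} : Finset V), ∀ t ∈ ({f, g, h} : Finset V), ¬ G.Adj s t :=
    fun s hs t ht => not_adj_of_linked_fourCycles hV hdeg hst h₁ h₂ hax hex hx hcompl hs ht
  obtain ⟨T, hT, hTx⟩ := hst x
  have hcases (v : V) (hv : v ∈ T) : v = b ∨ v = c ∨ v = d ∨ v = f ∨ v = g ∨ v = h := by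
    have haT : v ≠ a := by rintro rfl; exact (hTx v hv).2 hax.symm
    have heT : v ≠ e := by rintro rfl; exact (hTx v hv).2 hex.symm
    have hvx : v ≠ x := (hTx v hv).1
    have := Finset.ext_iff.1 hcompl v
    simp only [Finset.mem_compl, Finset.mem_insert, Finset.mem_singleton, haT, heT, hvx,
      false_or, or_false] at this
    clear * - this
    tauto
  simp only [Finset.mem_insert, Finset.mem_singleton, forall_eq_or_imp, forall_eq] at hcross
  obtain ⟨⟨bf, bg, bh⟩, ⟨cf, cg, ch⟩, df, dg, dh⟩ := hcross
  obtain ⟨-, -, nac, nbd⟩ := h₁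
  obtain ⟨-, -, neg, nfh⟩ := h₂
  have ndb : ¬ G.Adj d b := fun h => nbd h.symm
  have nhf : ¬ G.Adj h f := fun h => nfh h.symm
  have uniq {v m : V} (hv : v ∈ T) (hm : ∀ y ∈ T, G.Adj v y → y = m) : False := by
    obtain ⟨y, hy, z, hz, h1, h2, h3, -⟩ := (hT.2 v hv).exists_pair
    exact h3 ((hm z hz h2).trans (hm y hy h1).symm)
  have hbT : b ∉ T := fun hb => uniq (m := c) hb fun y hy hby => by
    rcases hcases y hy with rfl | rfl | rfl | rfl | rfl | rfl <;>
      first | rfl | contradiction | exact absurd rfl hby.ne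
  have hdT : d ∉ T := fun hd => uniq (m := c) hd fun y hy hby => by
    rcases hcases y hy with rfl | rfl | rfl | rfl | rfl | rfl <;>
      first | rfl | contradiction | exact absurd rfl hby.ne
  have hfT : f ∉ T := fun hf => uniq (m := g) hf fun y hy hby => by
    have := hby.symm
    rcases hcases y hy with rfl | rfl | rfl | rfl | rfl | rfl <;>
      first | rfl | contradiction | exact absurd rfl hby.ne
  have hhT : h ∉ T := fun hh => uniq (m := g) hh fun y hy hby => by
    have := hby.symm
    rcases hcases y hy with rfl | rfl | rfl | rfl | rfl | rfl <;>
      first | rfl | contradiction | exact absurd rfl hby.ne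
  obtain ⟨v, hv⟩ := hT.1
  have hcg (v : V) (hv : v ∈ T) : v = c ∨ v = g := by
    rcases hcases v hv with rfl | rfl | rfl | rfl | rfl | rfl <;>
      first | contradiction | exact .inl rfl | exact .inr rfl
  refine uniq (m := v) hv fun y hy hvy => ?_
  rcases hcg y hy with rfl | rfl <;> rcases hcg v hv with rfl | rfl
  exacts [rfl, absurd hvy.symm cg, absurd hvy cg, rfl]

theorem false_of_fourCycle (hG : G.Connected) (hV : Fintype.card V ≤ 9)
    (hdeg : ∀ v, ∀ s : Finset V, (∀ x ∈ s, G.Adj v x) → s.card ≤ 3)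
    (hst : ∀ p, ∃ T, IsStuckSet G T ∧ ∀ t ∈ T, t ≠ p ∧ ¬ G.Adj p t) {a b c d : V}
    (h₁ : IsInducedFourCycle G a b c d) : False := by
  have base (a b c d e : V) (h₁ : IsInducedFourCycle G a b c d) (hae : G.Adj a e)
      (he : e ∉ ({a, b, c, d} : Finset V)) : False := by
    have he' := he
    simp only [Finset.mem_insert, Finset.mem_singleton, not_or] at he'
    obtain ⟨hst₁, hcard⟩ := stuck_compl_of_fourCycle hV hdeg hst h₁ hae he'.2.1 he'.2.2.2
    obtain ⟨e', f, g, h, h₂, heq⟩ := hst₁.eq_fourCycle hcard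
    by_cases hlink : ∃ y ∈ ({e', f, g, h} : Finset V), G.Adj y e
    · obtain ⟨y, hy, hye⟩ := hlink
      simp only [Finset.mem_insert, Finset.mem_singleton] at hy
      rcases hy with rfl | rfl | rfl | rfl
      · exact false_of_linked_fourCycles hV hdeg hst h₁ h₂ hae hye he heq
      · exact false_of_linked_fourCycles hV hdeg hst h₁ h₂.rotate hae hye he (by grind)
      · exact false_of_linked_fourCycles hV hdeg hst h₁ h₂.rotate.rotate hae hye he (by grind)
      · exact false_of_linked_fourCycles hV hdeg hst h₁ h₂.rotate.rotate.rotate hae hye he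
          (by grind)
    · push Not at hlink
      have hmem (v : V) :
          v ∈ ({e', f, g, h} : Finset V) ↔ v ∉ ({a, b, c, d} : Finset V) ∧ v ≠ e := by
        rw [← heq, mem_compl_insert_four]
      obtain ⟨y, hy, s, hs, hys⟩ := exists_adj_boundary hG (S := {e', f, g, h}) (x := e') (y := e)
        (by simp) (by simp [hmem])
      have hse : s ≠ e := fun h => hlink y hy (h ▸ hys)
      have hs' : s ∈ ({a, b, c, d} : Finset V) := by
        by_contra hcon
        exact hs ((hmem s).2 ⟨hcon, hse⟩)
      have hy' := (hmem y).1 hy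
      have key := stuck_compl_of_fourCycle_of_mem hV hdeg hst h₁ hs' hy'.1 hys.symm
      obtain ⟨⟨z, hz, hez⟩, -⟩ := key.2 e (mem_compl_insert_four.2 ⟨he, hy'.2.symm⟩)
      exact hlink z ((hmem z).2 ⟨(mem_compl_insert_four.1 hz).1, hez.ne'⟩) hez.symm
  obtain ⟨T, hT, hTa⟩ := hst a
  obtain ⟨⟨hab, hbc, hcd, hda⟩, ⟨hac, hbd⟩, nac, nbd⟩ := id h₁
  have hbT : b ∉ T := fun hb => (hTa b hb).2 hab
  have haT : a ∉ T := fun ha => (hTa a ha).1 rfl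
  have hdT : d ∉ T := fun hd => (hTa d hd).2 hda.symm
  have hcT : c ∉ T := hT.notMem hdeg hbc.symm hcd hbd hbT hdT
  obtain ⟨t, ht⟩ := hT.1
  obtain ⟨s, hs, e, he, hse⟩ := exists_adj_boundary hG (S := {a, b, c, d}) (x := a) (y := t)
    (by simp) (by grind)
  have hs' := hs
  simp only [Finset.mem_insert, Finset.mem_singleton] at hs'
  rcases hs' with rfl | rfl | rfl | rfl
  · exact base _ _ _ _ e h₁ hse he
  · exact base _ _ _ _ e h₁.rotate hse (by grind)
  · exact base _ _ _ _ e h₁.rotate.rotate hse (by grind)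
  · exact base _ _ _ _ e h₁.rotate.rotate.rotate hse (by grind)

theorem exists_outer_adj_of_fiveCycle (hV : Fintype.card V ≤ 9)
    (hst : ∀ p, ∃ T, IsStuckSet G T ∧ ∀ t ∈ T, t ≠ p ∧ ¬ G.Adj p t)
    (hfour : ∀ a b c d, ¬ IsInducedFourCycle G a b c d) {a b c d e x : V}
    (h : IsInducedFiveCycle G a b c d e) (hax : G.Adj a x)
    (hx : x ∉ ({a, b, c, d, e} : Finset V)) :
    ∃ y z, G.Adj c y ∧ G.Adj d z ∧ y ≠ z ∧ y ≠ x ∧ z ≠ x ∧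
      y ∉ ({a, b, c, d, e} : Finset V) ∧ z ∉ ({a, b, c, d, e} : Finset V) := by
  obtain ⟨⟨hab, hbc, hcd, hde, hea⟩, nac, nbd, nce, nda, neb⟩ := h
  obtain ⟨T, hT, hTa⟩ := hst a
  have hbe : b ≠ e := by rintro rfl; exact nce hbc.symm
  simp only [Finset.mem_insert, Finset.mem_singleton, not_or] at hx
  obtain ⟨hxa, hxb, hxc, hxd, hxe⟩ := hx
  have hsub : T ⊆ ({a, b, e, x} : Finset V)ᶜ := by
    intro t ht
    simp only [Finset.mem_compl, Finset.mem_insert, Finset.mem_singleton, not_or]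
    refine ⟨(hTa t ht).1, ?_, ?_, ?_⟩ <;> rintro rfl
    exacts [(hTa _ ht).2 hab, (hTa _ ht).2 hea.symm, (hTa _ ht).2 hax]
  have h4 : ({a, b, e, x} : Finset V).card = 4 := by
    have := hab.ne
    have := hea.ne
    grind
  have h5 : (({a, b, e, x} : Finset V)ᶜ).card ≤ 5 := by
    rw [Finset.card_compl, h4]
    omega
  have hT5 := (hT.eq_fiveCycle hfour ((Finset.card_le_card hsub).trans h5)).1
  have heq := Finset.eq_of_subset_of_card_le hsub (h5.trans hT5.ge)
  have hcT : c ∈ T := by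
    rw [heq]
    simp only [Finset.mem_compl, Finset.mem_insert, Finset.mem_singleton, not_or]
    refine ⟨?_, hbc.ne', ?_, Ne.symm hxc⟩ <;> rintro rfl
    exacts [nda hcd.symm, neb hbc.symm]
  have hdT : d ∈ T := by
    rw [heq]
    simp only [Finset.mem_compl, Finset.mem_insert, Finset.mem_singleton, not_or]
    refine ⟨?_, ?_, hde.ne, Ne.symm hxd⟩ <;> rintro rfl
    exacts [nac hcd.symm, neb hde.symm]
  obtain ⟨y, hy, hcy, hyd, ndy⟩ := (hT.2 c hcT).2 d hdT hcd
  obtain ⟨z, hz, hdz, hzc, -⟩ := (hT.2 d hdT).2 c hcT hcd.symm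
  rw [heq] at hy hz
  simp only [Finset.mem_compl, Finset.mem_insert, Finset.mem_singleton, not_or] at hy hz ⊢
  exact ⟨y, z, hcy, hdz, fun h => ndy (h ▸ hdz), hy.2.2.2, hz.2.2.2,
    ⟨hy.1, hy.2.1, hcy.ne', hyd, hy.2.2.1⟩, ⟨hz.1, hz.2.1, hzc, hdz.ne', hz.2.2.1⟩⟩

theorem false_of_fiveCycle (hG : G.Connected) (hV : Fintype.card V ≤ 9)
    (hdeg : ∀ v, ∀ s : Finset V, (∀ x ∈ s, G.Adj v x) → s.card ≤ 3)
    (hst : ∀ p, ∃ T, IsStuckSet G T ∧ ∀ t ∈ T, t ≠ p ∧ ¬ G.Adj p t)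
    (hfour : ∀ a b c d, ¬ IsInducedFourCycle G a b c d) {u a b c d e : V}
    (h : IsInducedFiveCycle G a b c d e)
    (hu : ∀ t ∈ ({a, b, c, d, e} : Finset V), t ≠ u ∧ ¬ G.Adj u t)
    (hrest : ∀ t ∉ ({a, b, c, d, e} : Finset V), t = u ∨ G.Adj u t) : False := by
  have rot (a b c d e : V) : ({b, c, d, e, a} : Finset V) = {a, b, c, d, e} := by
    ext
    simp only [Finset.mem_insert, Finset.mem_singleton]
    tauto
  have uniq {a b c d e x y : V} (h : IsInducedFiveCycle G a b c d e) (hax : G.Adj a x)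
      (hay : G.Adj a y) (hx : x ∉ ({a, b, c, d, e} : Finset V))
      (hy : y ∉ ({a, b, c, d, e} : Finset V)) : y = x := by
    obtain ⟨⟨hab, hbc, -, -, hea⟩, -, -, nce, -⟩ := h
    simp only [Finset.mem_insert, Finset.mem_singleton, not_or] at hx hy
    have hbe : b ≠ e := by rintro rfl; exact nce hbc.symm
    have := eq_of_adj_of_card_le (hdeg a) hab hea.symm hax hay hbe
      (Ne.symm hx.2.1) (Ne.symm hx.2.2.2.2)
    tauto
  have base {a b c d e x : V} (h : IsInducedFiveCycle G a b c d e)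
      (hu : ∀ t ∈ ({a, b, c, d, e} : Finset V), t ≠ u ∧ ¬ G.Adj u t)
      (hrest : ∀ t ∉ ({a, b, c, d, e} : Finset V), t = u ∨ G.Adj u t) (hax : G.Adj a x)
      (hx : x ∉ ({a, b, c, d, e} : Finset V)) : False := by
    have hb := h.rotate
    have hc := hb.rotate
    have hd := hc.rotate
    have he := hd.rotate
    have eb := rot a b c d e
    have ec := (rot b c d e a).trans eb
    have ed := (rot c d e a b).trans ec
    have ee := (rot d e a b c).trans ed
    obtain ⟨y₂, y₃, hc2, hd3, h23, h2, h3, hy2, hy3⟩ :=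
      exists_outer_adj_of_fiveCycle hV hst hfour h hax hx
    obtain ⟨y₄, y₀, he4, ha0, h40, h42, h02, hy4, hy0⟩ :=
      exists_outer_adj_of_fiveCycle hV hst hfour hc hc2 (ec ▸ hy2)
    obtain ⟨z₀, y₁, hza, hb1, h01, -, h13, hz0, hy1⟩ :=
      exists_outer_adj_of_fiveCycle hV hst hfour hd hd3 (ed ▸ hy3)
    obtain ⟨z₁, z₂, hzb, hzc, hz12, -, -, hz1, hz2⟩ :=
      exists_outer_adj_of_fiveCycle hV hst hfour he he4 (by rwa [ee, ← ec])
    rw [ec] at hy4 hy0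
    rw [ed] at hz0 hy1
    rw [ee] at hz1 hz2
    obtain rfl := uniq h hax hza hx hz0
    obtain rfl := uniq hb hb1 hzb (eb ▸ hy1) (eb ▸ hz1)
    obtain rfl := uniq hc hc2 hzc (ec ▸ hy2) (ec ▸ hz2)
    have hadj {w y : V} (hw : w ∈ ({a, b, c, d, e} : Finset V)) (hwy : G.Adj w y)
        (hy : y ∉ ({a, b, c, d, e} : Finset V)) : G.Adj u y := by
      refine (hrest y hy).resolve_left ?_
      rintro rfl
      exact (hu w hw).2 hwy.symm
    have := eq_of_adj_of_card_le (hdeg u) (hadj (by simp) hax hx) (hadj (by simp) hc2 hy2)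
      (hadj (by simp) hd3 hy3) (hadj (by simp) hb1 hy1) h2.symm h3.symm h23
    rcases this with h | h | h
    exacts [h01 h.symm, hz12 h, h13 h]
  obtain ⟨s, hs, t, ht, hadj⟩ := exists_adj_boundary hG (S := {a, b, c, d, e}) (x := a) (y := u)
    (by simp) (fun h => (hu u h).1 rfl)
  have eb := rot a b c d e
  have ec := (rot b c d e a).trans eb
  have ed := (rot c d e a b).trans ec
  have ee := (rot d e a b c).trans ed
  have hs' := hs
  simp only [Finset.mem_insert, Finset.mem_singleton] at hs'
  rcases hs' with rfl | rfl | rfl | rfl | rfl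
  · exact base h hu hrest hadj ht
  · exact base h.rotate (eb ▸ hu) (eb ▸ hrest) hadj (eb ▸ ht)
  · exact base h.rotate.rotate (ec ▸ hu) (ec ▸ hrest) hadj (ec ▸ ht)
  · exact base h.rotate.rotate.rotate (ed ▸ hu) (ed ▸ hrest) hadj (ed ▸ ht)
  · exact base h.rotate.rotate.rotate.rotate (ee ▸ hu) (ee ▸ hrest) hadj (ee ▸ ht)

theorem false_of_degree_le_three (hG : G.Connected) (hV : Fintype.card V ≤ 9)
    (hst : ∀ p, ∃ T, IsStuckSet G T ∧ ∀ t ∈ T, t ≠ p ∧ ¬ G.Adj p t) {u : V} {N : Finset V}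
    (hN : ∀ x, x ∈ N ↔ G.Adj u x)
    (hmax : ∀ v, ∀ s : Finset V, (∀ x ∈ s, G.Adj v x) → s.card ≤ N.card)
    (hN3 : N.card ≤ 3) : False := by
  obtain ⟨T, hT, hTu⟩ := hst u
  have huT : u ∉ T := fun h => (hTu u h).1 rfl
  rcases hN3.lt_or_eq with hlt | h3
  · obtain ⟨x, hx⟩ := hT.1
    obtain ⟨s, hs, t, ht, hst⟩ := exists_adj_boundary hG hx huT
    obtain ⟨y, hy, z, hz, hsy, hsz, hzy, -⟩ := (hT.2 s hs).exists_pair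
    have hc : ({y, z, t} : Finset V).card = 3 := by grind
    have := hmax s {y, z, t} (by grind)
    omega
  · have hdeg : ∀ v, ∀ s : Finset V, (∀ x ∈ s, G.Adj v x) → s.card ≤ 3 :=
      fun v s hs => h3 ▸ hmax v s hs
    have hsub : T ⊆ (insert u N)ᶜ := fun t ht => by
      simpa [hN] using hTu t ht
    have hcard : (insert u N)ᶜ.card ≤ 5 := by
      rw [Finset.card_compl, Finset.card_insert_of_notMem (by simp [hN]), h3]
      omega
    have hfour : ∀ a b c d, ¬ IsInducedFourCycle G a b c d := fun a b c d h =>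
      false_of_fourCycle hG hV hdeg hst h
    obtain ⟨h5, a, b, c, d, e, h, rfl⟩ :=
      hT.eq_fiveCycle hfour ((Finset.card_le_card hsub).trans hcard)
    have heq := Finset.eq_of_subset_of_card_le hsub (hcard.trans h5.ge)
    refine false_of_fiveCycle hG hV hdeg hst hfour h hTu fun t ht => ?_
    rw [heq] at ht
    simpa [hN, or_iff_not_imp_left] using ht

end SmallDegree

section LargeDegree

variable {V : Type*} {G : SimpleGraph V}

/-- Two cops at `u` and `a` who leave only `c` unguarded win, provided that `c` has a single
escape `y` once the first cop has moved to `x`, and `y` can then be surrounded. -/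
theorem CopsWin.of_trap {u a a' c x y : V}
    (hcover : ∀ t, t = c ∨ u = t ∨ G.Adj u t ∨ a = t ∨ G.Adj a t)
    (hux : G.Adj u x) (hcx : G.Adj c x)
    (hc : ∀ t, G.Adj c t → t = y ∨ t = x ∨ a = t ∨ G.Adj a t)
    (haa' : a' = a ∨ G.Adj a a')
    (hy : ∀ t, t = y ∨ G.Adj y t → u = t ∨ G.Adj u t ∨ a' = t ∨ G.Adj a' t) : CopsWin G 2 := by
  refine ⟨![u, a], fun r => ?_⟩
  rcases hcover r with rfl | h | h | h | h
  · refine .step _ _ ![x, a] (by simp [Fin.forall_fin_two, hux]) fun t ht => ?_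
    rcases ht with rfl | ht
    · exact .of_adj 0 (.inr hcx.symm)
    · rcases hc t ht with rfl | h | h | h
      · refine .step _ _ ![u, a'] (by simpa [Fin.forall_fin_two, hux.symm] using haa')
          fun s hs => ?_
        rcases hy s hs with h | h | h | h
        exacts [.of_adj 0 (.inl h), .of_adj 0 (.inr h), .of_adj 1 (.inl h), .of_adj 1 (.inr h)]
      exacts [.of_adj 0 (.inl h.symm), .of_adj 1 (.inl h), .of_adj 1 (.inr h)]
  exacts [.of_adj 0 (.inl h), .of_adj 0 (.inr h), .of_adj 1 (.inl h), .of_adj 1 (.inr h)]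

variable [DecidableEq V]

/-- A vertex of degree at most four has no neighbours besides four given ones. -/
theorem eq_of_adj_of_card_le_four {v a b c d e : V}
    (hdeg : ∀ s : Finset V, (∀ x ∈ s, G.Adj v x) → s.card ≤ 4) (ha : G.Adj v a)
    (hb : G.Adj v b) (hc : G.Adj v c) (hd : G.Adj v d) (he : G.Adj v e)
    (hdist : ({a, b, c, d} : Finset V).card = 4) : e ∈ ({a, b, c, d} : Finset V) := by
  by_contra h
  have := hdeg (insert e {a, b, c, d}) (by grind)
  rw [Finset.card_insert_of_notMem h, hdist] at this
  omega

variable [Fintype V]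

theorem exists_pair_of_fourCycle (hG : G.Connected) (hno : ¬ CopsWin G 2) {u a b c d : V}
    (h : IsInducedFourCycle G a b c d) (hua : ¬ G.Adj u a) (hau : u ≠ a)
    (huc : ¬ G.Adj u c) (hcu : u ≠ c)
    (hrest : ∀ t ∉ ({a, b, c, d} : Finset V), t = u ∨ G.Adj u t) :
    ∃ x y, x ≠ y ∧ G.Adj c x ∧ G.Adj c y ∧ G.Adj u x ∧ G.Adj u y ∧ ¬ G.Adj a x ∧ ¬ G.Adj a y := by
  obtain ⟨⟨hab, hbc, hcd, hda⟩, ⟨hac, hbd⟩, nac, nbd⟩ := h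
  have := Classical.decRel G.Adj
  let S : Finset V := Finset.univ.filter fun t => t ≠ a ∧ ¬ G.Adj a t
  have hmemS (t : V) : t ∈ S ↔ t ≠ a ∧ ¬ G.Adj a t := by simp [S]
  have hS : ¬ Dismantlable G S := fun h =>
    hno (.of_dismantlable hG a (fun t => by rw [hmemS]; tauto) h)
  have huS : u ∈ S := (hmemS u).2 ⟨hau, fun h => hua h.symm⟩
  obtain ⟨T, hKT, hTS, hT, hst⟩ := exists_stuck_of_not_dismantlable
    (Finset.singleton_subset_iff.2 huS) hS
  have huT : u ∈ T := hKT (by simp)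
  have hcases (t : V) (ht : t ∈ T) : t = u ∨ G.Adj u t ∨ t = c := by
    have h1 := (hmemS t).1 (hTS ht)
    by_cases hm : t ∈ ({a, b, c, d} : Finset V)
    · simp only [Finset.mem_insert, Finset.mem_singleton] at hm
      rcases hm with rfl | rfl | rfl | rfl
      exacts [absurd rfl h1.1, absurd hab h1.2, .inr (.inr rfl), absurd hda.symm h1.2]
    · exact (hrest t hm).imp_right .inl
  have hnbr (x : V) (hx : x ∈ T) (hux : G.Adj u x) : c ∈ T ∧ G.Adj c x := by
    obtain ⟨z, hz, hxz, hzu, nuz⟩ := (hst x hx (by simpa using hux.ne')).2 u huT hux.symm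
    obtain rfl := ((hcases z hz).resolve_left hzu).resolve_left nuz
    exact ⟨hz, hxz.symm⟩
  have hcT : c ∈ T := by
    by_contra hcT
    refine hT (.remove T u huT ?_ ?_)
    · rintro ⟨⟨y, hy, huy⟩, -⟩
      exact hcT (hnbr y hy huy).1
    · suffices T.erase u = ∅ from this ▸ .empty
      refine Finset.eq_empty_of_forall_notMem fun t ht => ?_
      obtain ⟨htu, ht⟩ := Finset.mem_erase.1 ht
      rcases (hcases t ht).resolve_left htu with h | rfl
      exacts [hcT (hnbr t ht h).1, hcT ht]
  obtain ⟨x, hx, y, hy, hcx, hcy, hyx, -⟩ := (hst c hcT (by simpa using hcu.symm)).exists_pair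
  have hadj (t : V) (ht : t ∈ T) (hct : G.Adj c t) : G.Adj u t := by
    rcases hcases t ht with rfl | h | rfl
    exacts [absurd hct.symm huc, h, absurd rfl hct.ne]
  exact ⟨x, y, hyx.symm, hcx, hcy, hadj x hx hcx, hadj y hy hcy, ((hmemS x).1 (hTS hx)).2,
    ((hmemS y).1 (hTS hy)).2⟩

theorem CopsWin.two_of_fourCycle (hG : G.Connected)
    (hdeg : ∀ v, ∀ s : Finset V, (∀ x ∈ s, G.Adj v x) → s.card ≤ 4) {u a b c d : V}
    (h : IsInducedFourCycle G a b c d)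
    (hu : ∀ t ∈ ({a, b, c, d} : Finset V), u ≠ t ∧ ¬ G.Adj u t)
    (hrest : ∀ t ∉ ({a, b, c, d} : Finset V), t = u ∨ G.Adj u t) : CopsWin G 2 := by
  by_contra hno
  have rot : ({b, c, d, a} : Finset V) = {a, b, c, d} := by
    ext
    simp only [Finset.mem_insert, Finset.mem_singleton]
    tauto
  obtain ⟨ua, nua⟩ := hu a (by simp)
  obtain ⟨ub, nub⟩ := hu b (by simp)
  obtain ⟨uc, nuc⟩ := hu c (by simp)
  obtain ⟨ud, nud⟩ := hu d (by simp)
  obtain ⟨x, y, hxy, hcx, hcy, hux, huy, hax, hay⟩ :=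
    exists_pair_of_fourCycle hG hno h nua ua nuc uc hrest
  obtain ⟨x', y', hxy', hdx', hdy', hux', huy', hbx', hby'⟩ :=
    exists_pair_of_fourCycle hG hno h.rotate nub ub nud ud (rot ▸ hrest)
  obtain ⟨⟨hab, hbc, hcd, hda⟩, ⟨hac, hbd⟩, nac, nbd⟩ := h
  have hcN (t : V) (ht : G.Adj c t) : t ∈ ({b, d, x, y} : Finset V) := by
    refine eq_of_adj_of_card_le_four (hdeg c) hbc.symm hcd hcx hcy ht ?_
    grind
  have hdN (t : V) (ht : G.Adj d t) : t ∈ ({a, c, x', y'} : Finset V) := by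
    refine eq_of_adj_of_card_le_four (hdeg d) hda hcd.symm hdx' hdy' ht ?_
    grind
  have hnot : ¬ (G.Adj b y ∧ G.Adj d y) := by
    rintro ⟨hby, hdy⟩
    have := hdN y hdy
    simp only [Finset.mem_insert, Finset.mem_singleton] at this
    rcases this with rfl | rfl | rfl | rfl
    exacts [nua huy, nuc huy, hbx' hby, hby' hby]
  have hcover (t : V) : t = c ∨ u = t ∨ G.Adj u t ∨ a = t ∨ G.Adj a t := by
    by_cases ht : t ∈ ({a, b, c, d} : Finset V)
    · simp only [Finset.mem_insert, Finset.mem_singleton] at ht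
      rcases ht with rfl | rfl | rfl | rfl <;> simp [hab, hda.symm]
    · rcases hrest t ht with rfl | h <;> simp [*]
  have hc (t : V) (ht : G.Adj c t) : t = y ∨ t = x ∨ a = t ∨ G.Adj a t := by
    have := hcN t ht
    simp only [Finset.mem_insert, Finset.mem_singleton] at this
    rcases this with rfl | rfl | rfl | rfl <;> simp [hab, hda.symm]
  have hguard (t : V) (ht : G.Adj y t) : t = b ∨ t = c ∨ t = d ∨ u = t ∨ G.Adj u t := by
    by_cases hm : t ∈ ({a, b, c, d} : Finset V)
    · simp only [Finset.mem_insert, Finset.mem_singleton] at hm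
      rcases hm with rfl | hm
      · exact absurd ht.symm hay
      · tauto
    · rcases hrest t hm with rfl | h <;> simp [*]
  by_cases hby : G.Adj b y
  · refine hno (.of_trap hcover hux hcx hc (a' := b) (.inr hab) fun t ht => ?_)
    rcases ht with rfl | ht
    · exact .inr (.inl huy)
    · rcases hguard t ht with rfl | rfl | rfl | h
      exacts [.inr (.inr (.inl rfl)), .inr (.inr (.inr hbc)), absurd ⟨hby, ht.symm⟩ hnot,
        h.imp_right .inl]
  · refine hno (.of_trap hcover hux hcx hc (a' := d) (.inr hda.symm) fun t ht => ?_)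
    rcases ht with rfl | ht
    · exact .inr (.inl huy)
    · rcases hguard t ht with rfl | rfl | rfl | h
      exacts [absurd ht.symm hby, .inr (.inr (.inr hcd.symm)), .inr (.inr (.inl rfl)),
        h.imp_right .inl]

end LargeDegree

theorem CopsWin.two_of_card_le_nine {V : Type*} [Fintype V] {G : SimpleGraph V}
    (hG : G.Connected) (hV : Fintype.card V ≤ 9) : CopsWin G 2 := by
  classical
  by_contra hno
  have hst (p : V) : ∃ T, IsStuckSet G T ∧ ∀ t ∈ T, t ≠ p ∧ ¬ G.Adj p t := by
    obtain ⟨T, -, hTS, hT, h⟩ := exists_stuck_of_not_dismantlable (G := G)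
      (S := Finset.univ.filter fun t => t ≠ p ∧ ¬ G.Adj p t) (Finset.empty_subset _)
      fun h => hno (.of_dismantlable hG p (fun t => by simp; tauto) h)
    refine ⟨T, ⟨Finset.nonempty_iff_ne_empty.2 ?_, fun x hx => h x hx (by simp)⟩, fun t ht => ?_⟩
    · rintro rfl
      exact hT .empty
    · simpa using hTS ht
  have := hG.nonempty
  obtain ⟨u, hu⟩ := G.exists_maximal_degree_vertex
  have hmax (v : V) (s : Finset V) (hs : ∀ x ∈ s, G.Adj v x) :
      s.card ≤ (G.neighborFinset u).card := by
    have h1 : s.card ≤ G.degree v := Finset.card_le_card fun x hx => by simpa using hs x hx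
    rw [G.card_neighborFinset_eq_degree, ← hu]
    exact h1.trans (G.degree_le_maxDegree v)
  by_cases hN3 : (G.neighborFinset u).card ≤ 3
  · exact false_of_degree_le_three hG hV hst (fun x => G.mem_neighborFinset u x) hmax hN3
  obtain ⟨T, hT, hTu⟩ := hst u
  have hsub : T ⊆ (insert u (G.neighborFinset u))ᶜ := fun t ht => by
    simpa using hTu t ht
  have hcompl := Finset.card_compl (insert u (G.neighborFinset u))
  rw [Finset.card_insert_of_notMem (by simp)] at hcompl
  have hle := Finset.card_le_card hsub
  have h4 := hT.four_le_card
  obtain ⟨a, b, c, d, h, rfl⟩ := hT.eq_fourCycle (by omega)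
  have heq := Finset.eq_of_subset_of_card_le hsub (by omega)
  refine hno (.two_of_fourCycle hG (fun v s hs => (hmax v s hs).trans (by omega)) h
    (fun t ht => ⟨(hTu t ht).1.symm, (hTu t ht).2⟩) fun t ht => ?_)
  rw [heq] at ht
  simpa [or_iff_not_imp_left] using ht

/-- If `G` is a finite connected graph on `n` vertices with maximum
degree `Δ > n - 11`, then `c(G) ≤ 3`. -/
theorem copNumber_le_three_of_high_maxDegree {V : Type*} [Fintype V] (G : SimpleGraph V)
    [DecidableRel G.Adj] (hG : G.Connected)
    (h : (Fintype.card V : ℤ) - 11 < (G.maxDegree : ℤ)) :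
    copNumber G ≤ 3 := by
  classical
  have := hG.nonempty
  obtain ⟨v, hv⟩ := G.exists_maximal_degree_vertex
  have hcard : Nat.card {w // w ≠ v ∧ ¬ G.Adj v w} ≤ 9 := by
    have hset : (Finset.univ.filter fun w => w ≠ v ∧ ¬ G.Adj v w)
        = (insert v (G.neighborFinset v))ᶜ := by
      ext
      simp
    rw [Nat.card_eq_fintype_card, Fintype.card_subtype, hset, Finset.card_compl,
      Finset.card_insert_of_notMem (by simp), G.card_neighborFinset_eq_degree]
    omega
  have hwin : CopsWin G 3 := .three_of_two hG 9 v hcard fun W _ H hH => .two_of_card_le_nine hH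
  refine csSup_le' ?_
  rintro _ ⟨C, rfl⟩
  have hC : C.supp = Set.univ := by
    obtain ⟨w, rfl⟩ := C.exists_rep
    exact Set.eq_univ_of_forall fun x => ConnectedComponent.sound (hG.preconnected x w)
  rw [hC]
  exact Nat.sInf_le (hwin.of_iso (induceUnivIso G).symm)
end
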